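/- For z > 0, the function z ↦ z^{-1/2}·(Ai'(-z)² + Bi'(-z)²) equals (1/2)·ξ·(J_{2/3}(ξ)² + Y_{2/3}(ξ)²) with ξ = (2/3)z^{3/2}, and consequently π·z^{-1/2}·(Ai'(-z)² + Bi'(-z)²) > 1 for all z > 0. -/

import Mathlib

open Filter Set Topology

lemma ab_sol (J J' J'' : ℝ → ℝ)
    (hJ : ∀ x : ℝ, 0 < x → HasDerivAt J (J' x) x)
    (hJ' : ∀ x : ℝ, 0 < x → HasDerivAt J' (J'' x) x)
    (hJode : ∀ x : ℝ, 0 < x →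
      x^2 * J'' x + x * J' x + (x^2 - (2/3)^2) * J x = 0) (z : ℝ) (hz : 0 < z) :
    HasDerivAt (fun z : ℝ => z * J ((2/3) * z ^ ((3:ℝ)/2)))
      (z * (J ((2/3) * z ^ ((3:ℝ)/2)) / z + Real.sqrt z * J' ((2/3) * z ^ ((3:ℝ)/2)))) z ∧
    HasDerivAt (fun z : ℝ => J ((2/3) * z ^ ((3:ℝ)/2)) / z
        + Real.sqrt z * J' ((2/3) * z ^ ((3:ℝ)/2)))
      (-(z * J ((2/3) * z ^ ((3:ℝ)/2)))) z := by
  have hξ : 0 < (2/3) * z ^ ((3:ℝ)/2) := by positivity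
  have h1 : HasDerivAt (fun z : ℝ => (2/3) * z ^ ((3:ℝ)/2)) (Real.sqrt z) z := by
    have := (Real.hasDerivAt_rpow_const (x := z) (p := (3:ℝ)/2) (Or.inl hz.ne')).const_mul (2/3)
    refine this.congr_deriv ?_
    rw [Real.sqrt_eq_rpow]; norm_num; ring
  have hs : 0 < Real.sqrt z := Real.sqrt_pos.2 hz
  have hs2 : Real.sqrt z ^ 2 = z := Real.sq_sqrt hz.le
  have h3 : z ^ ((3:ℝ)/2) = Real.sqrt z ^ 3 := by
    rw [Real.sqrt_eq_rpow, ← Real.rpow_natCast, ← Real.rpow_mul hz.le]; norm_num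
  have h2 := (hJ _ hξ).comp z h1
  have h2' := (hJ' _ hξ).comp z h1
  have hode := hJode _ hξ
  constructor
  · refine ((hasDerivAt_id z).mul h2).congr_deriv ?_
    simp only [Function.comp, id]
    field_simp
  · refine ((h2.div (hasDerivAt_id z) hz.ne').add
      ((Real.hasDerivAt_sqrt hz.ne').mul h2')).congr_deriv ?_
    simp only [Function.comp, id]
    rw [h3] at hode ⊢
    generalize Real.sqrt z = s at *
    subst hs2
    generalize J (2/3 * s^3) = A at *
    generalize J' (2/3 * s^3) = B at *
    generalize J'' (2/3 * s^3) = C at *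
    have : C = -(3/2) * B / s^3 - (s^6 - 1) / s^6 * A := by
      field_simp
      linear_combination (9/2) * hode
    rw [this]; field_simp; ring

lemma ab_lim (u a : ℝ → ℝ) (hu : ∀ z, HasDerivAt u (z * a z) z)
    (ha : ∀ z, HasDerivAt a (-u z) z) :
    Tendsto (fun z => (u z - u 0) / z ^ 2) (𝓝[>] 0) (𝓝 (a 0 / 2)) := by
  have hc : Continuous u := continuous_iff_continuousAt.2 fun z => (hu z).continuousAt
  have hca : Continuous a := continuous_iff_continuousAt.2 fun z => (ha z).continuousAt
  refine HasDerivAt.lhopital_zero_nhdsGT (f' := fun z => z * a z) (g' := fun z => 2 * z)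
    ?_ ?_ ?_ ?_ ?_ ?_
  · exact Eventually.of_forall fun z => (hu z).sub_const _
  · exact Eventually.of_forall fun z => by simpa using hasDerivAt_pow 2 z
  · filter_upwards [self_mem_nhdsWithin] with z hz
    exact mul_ne_zero two_ne_zero (ne_of_gt hz)
  · have : Continuous fun z => u z - u 0 := by fun_prop
    simpa using (this.tendsto 0).mono_left nhdsWithin_le_nhds
  · have : Continuous fun z : ℝ => z ^ 2 := by fun_prop
    simpa using (this.tendsto 0).mono_left nhdsWithin_le_nhds
  · have : Continuous fun z => a z / 2 := by fun_prop
    refine ((this.tendsto 0).mono_left nhdsWithin_le_nhds).congr' ?_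
    filter_upwards [self_mem_nhdsWithin] with z hz
    have : z ≠ 0 := ne_of_gt hz
    field_simp

lemma ab_const (f : ℝ → ℝ) (hf : ∀ z, 0 < z → HasDerivAt f 0 z) :
    ∃ c, ∀ z, 0 < z → f z = c := by
  refine ⟨f 1, fun z hz => ?_⟩
  refine isOpen_Ioi.is_const_of_deriv_eq_zero (s := Ioi (0:ℝ)) isPreconnected_Ioi
    (fun x hx => (hf x hx).differentiableAt.differentiableWithinAt) (fun x hx => (hf x hx).deriv)
    hz (by norm_num : (1:ℝ) ∈ Ioi 0)

lemma ab_zero (u₁ a₁ u₂ a₂ D b : ℝ → ℝ) (hu₁ : ∀ z, HasDerivAt u₁ (z * a₁ z) z)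
    (ha₁ : ∀ z, HasDerivAt a₁ (-u₁ z) z) (hu₂ : ∀ z, HasDerivAt u₂ (z * a₂ z) z)
    (ha₂ : ∀ z, HasDerivAt a₂ (-u₂ z) z)
    (hW : u₂ 0 * a₁ 0 - u₁ 0 * a₂ 0 ≠ 0)
    (hD : ∀ z, 0 < z → HasDerivAt D (z * b z) z) (hb : ∀ z, 0 < z → HasDerivAt b (-D z) z)
    (hl : Tendsto (fun z => D z / z ^ 2) (𝓝[>] 0) (𝓝 0)) : ∀ z, 0 < z → D z = 0 := by
  set w := u₂ 0 * a₁ 0 - u₁ 0 * a₂ 0 with hw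
  have hWc : ∀ z, u₂ z * a₁ z - u₁ z * a₂ z = w := by
    intro z
    refine is_const_of_deriv_eq_zero (f := fun z => u₂ z * a₁ z - u₁ z * a₂ z) ?_ ?_ z 0
    · exact fun x => (((hu₂ x).mul (ha₁ x)).sub ((hu₁ x).mul (ha₂ x))).differentiableAt
    · intro x
      refine ((((hu₂ x).mul (ha₁ x)).sub ((hu₁ x).mul (ha₂ x))).congr_deriv ?_).deriv
      ring
  obtain ⟨c₁, hc₁⟩ := ab_const (fun z => u₁ z * b z - a₁ z * D z) fun z hz =>
    (((hu₁ z).mul (hb z hz)).sub ((ha₁ z).mul (hD z hz))).congr_deriv (by ring)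
  obtain ⟨c₂, hc₂⟩ := ab_const (fun z => u₂ z * b z - a₂ z * D z) fun z hz =>
    (((hu₂ z).mul (hb z hz)).sub ((ha₂ z).mul (hD z hz))).congr_deriv (by ring)
  have hR : ∀ z, 0 < z → c₂ * u₁ z - c₁ * u₂ z = w * D z := by
    intro z hz
    rw [← hc₁ z hz, ← hc₂ z hz, ← hWc z]; ring
  let R := fun z => c₂ * u₁ z - c₁ * u₂ z
  let r := fun z => c₂ * a₁ z - c₁ * a₂ z
  have hRd : ∀ z, HasDerivAt R (z * r z) z := fun z =>
    (((hu₁ z).const_mul c₂).sub ((hu₂ z).const_mul c₁)).congr_deriv (by simp only [r]; ring)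
  have hrd : ∀ z, HasDerivAt r (-R z) z := fun z =>
    (((ha₁ z).const_mul c₂).sub ((ha₂ z).const_mul c₁)).congr_deriv (by simp only [R]; ring)
  have hRc : Continuous R := continuous_iff_continuousAt.2 fun z => (hRd z).continuousAt
  have hR0 : R 0 = 0 := by
    have t1 : Tendsto R (𝓝[>] 0) (𝓝 (R 0)) := (hRc.tendsto 0).mono_left nhdsWithin_le_nhds
    have t2 : Tendsto R (𝓝[>] 0) (𝓝 0) := by
      have h2 : Tendsto (fun z : ℝ => z ^ 2) (𝓝[>] 0) (𝓝 0) := by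
        have : Continuous fun z : ℝ => z ^ 2 := by fun_prop
        simpa using (this.tendsto 0).mono_left nhdsWithin_le_nhds
      have := (hl.mul h2).const_mul w
      simp only [mul_zero] at this
      refine this.congr' ?_
      filter_upwards [self_mem_nhdsWithin] with z hz
      have : z ≠ 0 := ne_of_gt hz
      simp only [R]
      rw [hR z hz]; field_simp
    exact tendsto_nhds_unique t1 t2
  have hr0 : r 0 = 0 := by
    have t1 := ab_lim R r hRd hrd
    have t2 := hl.const_mul w
    have t3 : Tendsto (fun z => (R z - R 0) / z ^ 2) (𝓝[>] 0) (𝓝 (w * 0)) := by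
      refine t2.congr' ?_
      filter_upwards [self_mem_nhdsWithin] with z hz
      rw [hR0]; simp only [R]; rw [hR z hz]; ring
    have := tendsto_nhds_unique t1 t3
    linarith
  simp only [R, r] at hR0 hr0
  have e1 : c₁ = 0 := by
    have : c₁ * w = 0 := by rw [hw]; linear_combination u₁ 0 * hr0 - a₁ 0 * hR0
    exact (mul_eq_zero.1 this).resolve_right hW
  have e2 : c₂ = 0 := by
    have : c₂ * w = 0 := by rw [hw]; linear_combination u₂ 0 * hr0 - a₂ 0 * hR0
    exact (mul_eq_zero.1 this).resolve_right hW
  intro z hz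
  have := hR z hz
  rw [e1, e2] at this
  simp only [zero_mul, sub_zero] at this
  exact (mul_eq_zero.1 this.symm).resolve_left hW

/-- Laplace-type integral `∫₀^∞ t^s exp(-zt - t³/12) dt`. -/
noncomputable def abI (s z : ℝ) : ℝ :=
  ∫ t in Ioi (0:ℝ), t ^ s * Real.exp (-(z * t) - t ^ 3 / 12)

lemma ab_isub (f g k : ℝ → ℝ) (hf : MeasureTheory.IntegrableOn f (Ioi 0))
    (hg : MeasureTheory.IntegrableOn g (Ioi 0)) (hk : MeasureTheory.IntegrableOn k (Ioi 0)) :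
    ∫ t in Ioi (0:ℝ), (f t - g t - k t) = (∫ t in Ioi (0:ℝ), f t) - (∫ t in Ioi (0:ℝ), g t)
      - ∫ t in Ioi (0:ℝ), k t := by
  have h := MeasureTheory.integral_sub (hf.sub hg) hk
  rw [MeasureTheory.integral_sub' hf hg] at h
  exact h

lemma ab_bound (z t : ℝ) (ht : 0 < t) : Real.exp (-(z * t) - t ^ 3 / 12)
    ≤ Real.exp ((2 * Real.sqrt (|z| + 1)) ^ 3 / 6) * Real.exp (-1 * t) := by
  rw [← Real.exp_add]
  apply Real.exp_le_exp.2
  have h1 : Real.sqrt (|z| + 1) ^ 2 = |z| + 1 := Real.sq_sqrt (by positivity)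
  have h0 : 0 ≤ Real.sqrt (|z| + 1) := Real.sqrt_nonneg _
  generalize Real.sqrt (|z| + 1) = k at *
  have h2 : 0 ≤ (t - 2 * k) ^ 2 * (t + 4 * k) := by positivity
  have h3 : -(z * t) ≤ |z| * t := by nlinarith [neg_abs_le z]
  have h4 : |z| = k ^ 2 - 1 := by linarith
  rw [h4] at h3
  nlinarith

lemma ab_int (s z : ℝ) (hs : -1 < s) :
    MeasureTheory.IntegrableOn (fun t : ℝ => t ^ s * Real.exp (-(z * t) - t ^ 3 / 12)) (Ioi 0) := by
  have h := (integrableOn_rpow_mul_exp_neg_mul_rpow (s := s) (p := 1) (b := 1) hs one_pos one_pos).const_mul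
    (Real.exp ((2 * Real.sqrt (|z| + 1)) ^ 3 / 6))
  refine MeasureTheory.Integrable.mono' h ?_ ?_
  · exact (by fun_prop : Measurable fun t : ℝ => t ^ s * Real.exp (-(z * t) - t ^ 3 / 12)).aestronglyMeasurable
  · filter_upwards [MeasureTheory.ae_restrict_mem measurableSet_Ioi] with t ht
    have ht : 0 < t := ht
    rw [Real.norm_of_nonneg (by positivity), Real.rpow_one]
    have := mul_le_mul_of_nonneg_left (ab_bound z t ht) (Real.rpow_nonneg ht.le s)
    linarith

lemma ab_der (s z : ℝ) (hs : -1 < s) : HasDerivAt (abI s) (-abI (s + 1) z) z := by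
  have hm : ∀ s x : ℝ, Measurable fun t : ℝ => t ^ s * Real.exp (-(x * t) - t ^ 3 / 12) :=
    fun s x => by fun_prop
  have := (hasDerivAt_integral_of_dominated_loc_of_deriv_le (μ := MeasureTheory.volume.restrict (Ioi (0:ℝ)))
    (F := fun x t => t ^ s * Real.exp (-(x * t) - t ^ 3 / 12))
    (F' := fun x t => -(t ^ (s + 1) * Real.exp (-(x * t) - t ^ 3 / 12)))
    (bound := fun t => t ^ (s + 1) * Real.exp (-((z - 1) * t) - t ^ 3 / 12))
    (s := Ioi (z - 1)) (x₀ := z) (Ioi_mem_nhds (by linarith)) 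
    (Eventually.of_forall fun x => (hm s x).aestronglyMeasurable) (ab_int s z hs)
    (hm (s + 1) z).neg.aestronglyMeasurable ?_ (ab_int (s + 1) (z - 1) (by linarith)) ?_).2
  · refine this.congr_deriv ?_
    rw [MeasureTheory.integral_neg]; rfl
  · filter_upwards [MeasureTheory.ae_restrict_mem measurableSet_Ioi] with t ht x hx
    have ht : 0 < t := ht
    have hx : z - 1 < x := hx
    rw [norm_neg, Real.norm_of_nonneg (by positivity)]
    gcongr
  · filter_upwards [MeasureTheory.ae_restrict_mem measurableSet_Ioi] with t ht x hx
    have ht : 0 < t := ht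
    have h1 : HasDerivAt (fun x : ℝ => -(x * t) - t ^ 3 / 12) (-t) x := by
      simpa using (((hasDerivAt_id x).mul_const t).neg).sub_const (t ^ 3 / 12)
    refine (h1.exp.const_mul (t ^ s)).congr_deriv ?_
    rw [Real.rpow_add_one ht.ne']; ring

lemma ab_parts (z : ℝ) : abI (-(1/2)) z = 2 * z * abI (1/2) z + abI (5/2) z / 2 := by
  have hd : ∀ t ∈ Ioi (0:ℝ), HasDerivAt (fun t : ℝ => t ^ (1/2:ℝ) * Real.exp (-(z * t) - t ^ 3 / 12))
      ((1/2) * (t ^ (-(1/2):ℝ) * Real.exp (-(z * t) - t ^ 3 / 12))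
        - z * (t ^ (1/2:ℝ) * Real.exp (-(z * t) - t ^ 3 / 12))
        - (1/4) * (t ^ (5/2:ℝ) * Real.exp (-(z * t) - t ^ 3 / 12))) t := by
    intro t ht
    have ht : 0 < t := ht
    have h1 : HasDerivAt (fun t : ℝ => -(z * t) - t ^ 3 / 12) (-z - t ^ 2 / 4) t := by
      refine ((((hasDerivAt_id t).const_mul z).neg).sub ((hasDerivAt_pow 3 t).div_const 12)).congr_deriv ?_
      norm_num; ring
    refine ((Real.hasDerivAt_rpow_const (p := (1/2:ℝ)) (Or.inl ht.ne')).mul h1.exp).congr_deriv ?_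
    have e1 : (1/2:ℝ) - 1 = -(1/2) := by norm_num
    have e2 : t ^ (5/2:ℝ) = t ^ (1/2:ℝ) * t ^ 2 := by
      rw [← Real.rpow_natCast, ← Real.rpow_add ht]; norm_num
    rw [e1, e2]; ring
  have i1 := (ab_int (-(1/2)) z (by norm_num)).const_mul (1/2)
  have i2 := (ab_int (1/2) z (by norm_num)).const_mul z
  have i3 := (ab_int (5/2) z (by norm_num)).const_mul (1/4)
  have hT : Tendsto (fun t : ℝ => t ^ (1/2:ℝ) * Real.exp (-(z * t) - t ^ 3 / 12)) atTop (𝓝 0) := by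
    have h := (tendsto_rpow_mul_exp_neg_mul_atTop_nhds_zero (1/2) 1 one_pos).const_mul
      (Real.exp ((2 * Real.sqrt (|z| + 1)) ^ 3 / 6))
    rw [mul_zero] at h
    refine squeeze_zero' ?_ ?_ h
    · filter_upwards [eventually_gt_atTop 0] with t ht
      positivity
    · filter_upwards [eventually_gt_atTop 0] with t ht
      have := mul_le_mul_of_nonneg_left (ab_bound z t ht) (Real.rpow_nonneg ht.le (1/2))
      linarith
  have hcont : Continuous (fun t : ℝ => t ^ (1/2:ℝ) * Real.exp (-(z * t) - t ^ 3 / 12)) := by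
    have : Continuous fun t : ℝ => t ^ (1/2:ℝ) := Real.continuous_rpow_const (by norm_num)
    fun_prop
  have := MeasureTheory.integral_Ioi_of_hasDerivAt_of_tendsto hcont.continuousWithinAt hd
    ((i1.sub i2).sub i3) hT
  rw [ab_isub _ _ _ i1 i2 i3,
    MeasureTheory.integral_const_mul, MeasureTheory.integral_const_mul,
    MeasureTheory.integral_const_mul] at this
  rw [Real.zero_rpow (by norm_num)] at this
  unfold abI
  linarith

lemma ab_at_zero (s : ℝ) (hs : -1 < s) :
    abI s 0 = 12 ^ ((s + 1) / 3) / 3 * Real.Gamma ((s + 1) / 3) := by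
  have h := integral_rpow_mul_exp_neg_mul_rpow (p := 3) (q := s) (b := 1/12) (by norm_num) hs (by norm_num)
  have e : (1/12:ℝ) ^ (-(s+1)/3) = 12 ^ ((s+1)/3) := by
    rw [one_div, Real.inv_rpow (by norm_num), ← Real.rpow_neg (by norm_num)]
    congr 1; ring
  rw [e] at h
  unfold abI
  rw [div_eq_mul_one_div (_ ^ _), ← h]
  apply MeasureTheory.integral_congr_ae
  filter_upwards with t
  have : t ^ (3:ℝ) = t ^ 3 := by exact_mod_cast Real.rpow_natCast t 3
  rw [this]
  congr 2
  ring

lemma ab_pos (s z : ℝ) (hs : -1 < s) : 0 < abI s z := by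
  unfold abI
  rw [MeasureTheory.setIntegral_pos_iff_support_of_nonneg_ae _ (ab_int s z hs)]
  · have : Function.support (fun t : ℝ => t ^ s * Real.exp (-(z * t) - t ^ 3 / 12)) ∩ Ioi 0 = Ioi 0 := by
      ext t
      simp only [mem_inter_iff, Function.mem_support, mem_Ioi, and_iff_right_iff_imp]
      intro ht
      positivity
    rw [this]; simp
  · filter_upwards [MeasureTheory.ae_restrict_mem measurableSet_Ioi] with t ht
    have ht : 0 < t := ht
    simp only [Pi.zero_apply]
    positivity

lemma ab_ineq (z : ℝ) (hz : 0 < z) :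
    Real.sqrt Real.pi * Real.sqrt z < z * abI (-(1/2)) z + abI (3/2) z / 2 := by
  set h : ℝ → ℝ := fun t => t ^ (-(1/2):ℝ) * (Real.exp (-(z * t)) - Real.exp (-(z * t) - t ^ 3 / 12))
    with hh
  set k : ℝ → ℝ := fun t => (1/2) * (t ^ (-(3/2):ℝ) * (Real.exp (-(z * t)) - Real.exp (-(z * t) - t ^ 3 / 12)))
    with hk
  have hE : ∀ t : ℝ, 0 < t → 0 ≤ Real.exp (-(z * t)) - Real.exp (-(z * t) - t ^ 3 / 12) ∧
      Real.exp (-(z * t)) - Real.exp (-(z * t) - t ^ 3 / 12) ≤ t ^ 3 / 12 * Real.exp (-(z * t)) := by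
    intro t ht
    have e : Real.exp (-(z * t) - t ^ 3 / 12) = Real.exp (-(z * t)) * Real.exp (-(t ^ 3 / 12)) := by
      rw [← Real.exp_add]; ring_nf
    have h1 : Real.exp (-(t ^ 3 / 12)) ≤ 1 := Real.exp_le_one_iff.2 (by have := pow_pos ht 3; linarith)
    have h2 := Real.add_one_le_exp (-(t ^ 3 / 12))
    have h3 := Real.exp_pos (-(z * t))
    rw [e]
    constructor <;> nlinarith
  have i1 := (ab_int (-(1/2)) z (by norm_num)).const_mul z
  have i2 := (ab_int (3/2) z (by norm_num)).const_mul (1/4)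
  have i3 : MeasureTheory.IntegrableOn (fun t : ℝ => z * (t ^ (-(1/2):ℝ) * Real.exp (-(z * t)))) (Ioi 0) := by
    have := (integrableOn_rpow_mul_exp_neg_mul_rpow (s := -(1/2)) (p := 1) (b := z) (by norm_num) one_pos hz).const_mul z
    simp only [Real.rpow_one, neg_mul] at this
    exact this
  have i4 : MeasureTheory.IntegrableOn k (Ioi 0) := by
    have := (integrableOn_rpow_mul_exp_neg_mul_rpow (s := 3/2) (p := 1) (b := z) (by norm_num) one_pos hz)
    simp only [Real.rpow_one, neg_mul] at this
    refine MeasureTheory.Integrable.mono' this ?_ ?_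
    · exact (by fun_prop : Measurable k).aestronglyMeasurable
    · filter_upwards [MeasureTheory.ae_restrict_mem measurableSet_Ioi] with t ht
      have ht : 0 < t := ht
      obtain ⟨h1, h2⟩ := hE t ht
      have h0 := Real.rpow_pos_of_pos ht (-(3/2))
      have h00 := Real.rpow_pos_of_pos ht (3/2)
      rw [Real.norm_of_nonneg (by simp only [hk]; positivity)]
      have e : t ^ (3/2:ℝ) = t ^ (-(3/2):ℝ) * t ^ 3 := by
        rw [← Real.rpow_natCast, ← Real.rpow_add ht]; norm_num
      simp only [hk]
      have h5 := mul_le_mul_of_nonneg_left h2 h0.le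
      have h6 : t ^ (-(3/2):ℝ) * (t ^ 3 / 12 * Real.exp (-(z * t))) = (1/12) * (t ^ (3/2:ℝ) * Real.exp (-(z * t))) := by
        rw [e]; ring
      have h7 : 0 ≤ t ^ (3/2:ℝ) * Real.exp (-(z * t)) := by positivity
      linarith
  have hknn : 0 ≤ ∫ t in Ioi (0:ℝ), k t := by
    apply MeasureTheory.setIntegral_nonneg measurableSet_Ioi
    intro t ht
    have := (hE t ht).1
    have ht : 0 < t := ht
    simp only [hk]
    positivity
  have hG : ∫ t in Ioi (0:ℝ), t ^ (-(1/2):ℝ) * Real.exp (-(z * t)) = Real.sqrt Real.pi / Real.sqrt z := by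
    have := Real.integral_rpow_mul_exp_neg_mul_Ioi (a := 1/2) (r := z) (by norm_num) hz
    rw [Real.Gamma_one_half_eq, ← Real.sqrt_eq_rpow, Real.sqrt_div zero_le_one, Real.sqrt_one] at this
    norm_num at this ⊢
    rw [this]; ring
  have hd : ∀ t ∈ Ioi (0:ℝ), HasDerivAt h
      (z * (t ^ (-(1/2):ℝ) * Real.exp (-(z * t) - t ^ 3 / 12))
        + (1/4) * (t ^ (3/2:ℝ) * Real.exp (-(z * t) - t ^ 3 / 12))
        - z * (t ^ (-(1/2):ℝ) * Real.exp (-(z * t))) - k t) t := by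
    intro t ht
    have ht : 0 < t := ht
    have h1 : HasDerivAt (fun t : ℝ => -(z * t) - t ^ 3 / 12) (-z - t ^ 2 / 4) t := by
      refine ((((hasDerivAt_id t).const_mul z).neg).sub ((hasDerivAt_pow 3 t).div_const 12)).congr_deriv ?_
      norm_num; ring
    have h2 : HasDerivAt (fun t : ℝ => -(z * t)) (-z) t := by
      refine (((hasDerivAt_id t).const_mul z).neg).congr_deriv ?_
      ring
    refine ((Real.hasDerivAt_rpow_const (p := (-(1/2):ℝ)) (Or.inl ht.ne')).mul (h2.exp.sub h1.exp)).congr_deriv ?_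
    have e1 : (-(1/2):ℝ) - 1 = -(3/2) := by norm_num
    have e2 : t ^ (3/2:ℝ) = t ^ (-(1/2):ℝ) * t ^ 2 := by
      rw [← Real.rpow_natCast, ← Real.rpow_add ht]; norm_num
    simp only [hk, Pi.sub_apply]
    rw [e1, e2]; ring
  have hle : ∀ t : ℝ, 0 < t → 0 ≤ h t ∧ h t ≤ t ^ (5/2:ℝ) * Real.exp (-z * t) := by
    intro t ht
    obtain ⟨h1, h2⟩ := hE t ht
    have h0 := Real.rpow_pos_of_pos ht (-(1/2))
    have e : t ^ (5/2:ℝ) = t ^ (-(1/2):ℝ) * t ^ 3 := by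
      rw [← Real.rpow_natCast, ← Real.rpow_add ht]; norm_num
    have h5 := mul_le_mul_of_nonneg_left h2 h0.le
    have h6 : t ^ (-(1/2):ℝ) * (t ^ 3 / 12 * Real.exp (-(z * t))) = (1/12) * (t ^ (5/2:ℝ) * Real.exp (-(z * t))) := by
      rw [e]; ring
    have h7 : 0 ≤ t ^ (5/2:ℝ) * Real.exp (-(z * t)) := by positivity
    refine ⟨by simp only [hh]; positivity, ?_⟩
    simp only [hh, neg_mul]
    linarith
  have h00 : h 0 = 0 := by simp [hh]
  have hT : Tendsto h atTop (𝓝 0) := by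
    refine squeeze_zero' ?_ ?_ (tendsto_rpow_mul_exp_neg_mul_atTop_nhds_zero (5/2) z hz)
    · filter_upwards [eventually_gt_atTop 0] with t ht using (hle t ht).1
    · filter_upwards [eventually_gt_atTop 0] with t ht using (hle t ht).2
  have hc : ContinuousWithinAt h (Ici 0) 0 := by
    have hcont : Continuous (fun t : ℝ => t ^ (5/2:ℝ) * Real.exp (-z * t)) := by
      have : Continuous fun t : ℝ => t ^ (5/2:ℝ) := Real.continuous_rpow_const (by norm_num)
      fun_prop
    have h5 : Tendsto (fun t : ℝ => t ^ (5/2:ℝ) * Real.exp (-z * t)) (𝓝[≥] 0) (𝓝 0) := by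
      have := (hcont.tendsto 0).mono_left (nhdsWithin_le_nhds (s := Ici 0))
      rwa [Real.zero_rpow (by norm_num), zero_mul] at this
    unfold ContinuousWithinAt
    rw [h00]
    have hle' : ∀ t : ℝ, 0 ≤ t → 0 ≤ h t ∧ h t ≤ t ^ (5/2:ℝ) * Real.exp (-z * t) := by
      intro t ht
      rcases ht.eq_or_lt with rfl | ht
      · rw [h00, Real.zero_rpow (by norm_num)]; simp
      · exact hle t ht
    refine squeeze_zero' ?_ ?_ h5
    · filter_upwards [self_mem_nhdsWithin] with t ht using (hle' t ht).1
    · filter_upwards [self_mem_nhdsWithin] with t ht using (hle' t ht).2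
  have := MeasureTheory.integral_Ioi_of_hasDerivAt_of_tendsto hc hd
    (((i1.add i2).sub i3).sub i4) hT
  rw [ab_isub (fun x => z * (x ^ (-(1 / 2):ℝ) * Real.exp (-(z * x) - x ^ 3 / 12)) +
      1 / 4 * (x ^ (3 / 2:ℝ) * Real.exp (-(z * x) - x ^ 3 / 12))) _ _ (i1.add i2) i3 i4,
    MeasureTheory.integral_add i1 i2,
    MeasureTheory.integral_const_mul, MeasureTheory.integral_const_mul,
    MeasureTheory.integral_const_mul, hG, h00] at this
  have hp := ab_pos (3/2) z (by norm_num)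
  have hs : z * (Real.sqrt Real.pi / Real.sqrt z) = Real.sqrt Real.pi * Real.sqrt z := by
    have h1 : Real.sqrt z ^ 2 = z := Real.sq_sqrt hz.le
    have h2 : Real.sqrt z ≠ 0 := (Real.sqrt_pos.2 hz).ne'
    field_simp
    linear_combination -h1
  unfold abI at hp ⊢
  linarith

lemma ab_K (f g N : ℝ → ℝ) (hf : ∀ z, HasDerivAt f (-2 * g z) z)
    (hg : ∀ z, HasDerivAt g (z * f z - N z) z) (hN : ∀ z, HasDerivAt N (2 * z * g z) z)
    (hf0 : f 0 = 0) (hg0 : g 0 = 0) (hN0 : N 0 = 0)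
    (u₁ a₁ u₂ a₂ : ℝ → ℝ) (hu₁ : ∀ z, HasDerivAt u₁ (z * a₁ z) z)
    (ha₁ : ∀ z, HasDerivAt a₁ (-u₁ z) z) (hu₂ : ∀ z, HasDerivAt u₂ (z * a₂ z) z)
    (ha₂ : ∀ z, HasDerivAt a₂ (-u₂ z) z)
    (hW : u₂ 0 * a₁ 0 - u₁ 0 * a₂ 0 ≠ 0) (z : ℝ) : N z = 0 := by
  have hWc : ∀ z, u₂ z * a₁ z - u₁ z * a₂ z = u₂ 0 * a₁ 0 - u₁ 0 * a₂ 0 := by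
    intro z
    refine is_const_of_deriv_eq_zero (f := fun z => u₂ z * a₁ z - u₁ z * a₂ z) ?_ ?_ z 0
    · exact fun x => (((hu₂ x).mul (ha₁ x)).sub ((hu₁ x).mul (ha₂ x))).differentiableAt
    · intro x
      refine ((((hu₂ x).mul (ha₁ x)).sub ((hu₁ x).mul (ha₂ x))).congr_deriv ?_).deriv
      ring
  have key : ∀ u a v b : ℝ → ℝ, (∀ z, HasDerivAt u (z * a z) z) → (∀ z, HasDerivAt a (-u z) z) →
      (∀ z, HasDerivAt v (z * b z) z) → (∀ z, HasDerivAt b (-v z) z) →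
      f z * (u z * v z) - g z * (a z * v z + b z * u z) + N z * (a z * b z) = 0 := by
    intro u a v b hu ha hv hb
    have hd : ∀ x, HasDerivAt (fun z => f z * (u z * v z) - g z * (a z * v z + b z * u z)
        + N z * (a z * b z)) 0 x := fun x =>
      ((((hf x).mul ((hu x).mul (hv x))).sub
        ((hg x).mul (((ha x).mul (hv x)).add ((hb x).mul (hu x))))).add
        ((hN x).mul ((ha x).mul (hb x)))).congr_deriv (by simp; ring)
    have := is_const_of_deriv_eq_zero (fun x => (hd x).differentiableAt) (fun x => (hd x).deriv) z 0
    simp only [hf0, hg0, hN0] at this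
    linarith
  have k1 := key u₁ a₁ u₁ a₁ hu₁ ha₁ hu₁ ha₁
  have k2 := key u₁ a₁ u₂ a₂ hu₁ ha₁ hu₂ ha₂
  have k3 := key u₂ a₂ u₂ a₂ hu₂ ha₂ hu₂ ha₂
  rw [← hWc z] at hW
  have : N z * (u₂ z * a₁ z - u₁ z * a₂ z) ^ 2 = 0 := by
    linear_combination u₂ z ^ 2 * k1 - 2 * u₁ z * u₂ z * k2 + u₁ z ^ 2 * k3
  exact (mul_eq_zero.1 this).resolve_right (pow_ne_zero 2 hW)

lemma ab_pow3 (c : ℝ) (hc : c = 3 ^ ((1:ℝ)/6)) : 0 < c ∧ c ^ 6 = 3 ∧ (3:ℝ) ^ (-(2:ℝ)/3) = c ^ 2 / 3 ∧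
    (3:ℝ) ^ (-(1:ℝ)/3) = c ^ 4 / 3 ∧ (3:ℝ) ^ (-(1:ℝ)/6) = c ^ 5 / 3 ∧ Real.sqrt 3 = c ^ 3 := by
  have h3 : (0:ℝ) < 3 := by norm_num
  have hp : ∀ n : ℕ, c ^ n = 3 ^ ((n:ℝ)/6) := by
    intro n
    rw [hc, ← Real.rpow_natCast, ← Real.rpow_mul h3.le]; congr 1; ring
  have h1 : ∀ x : ℝ, (3:ℝ) ^ x / 3 = 3 ^ (x - 1) := fun x => (Real.rpow_sub_one h3.ne' x).symm
  refine ⟨by rw [hc]; positivity, ?_, ?_, ?_, ?_, ?_⟩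
  · rw [hp]; norm_num
  · rw [hp, h1]; norm_num
  · rw [hp, h1]; norm_num
  · rw [hp, h1]; norm_num
  · rw [hp, Real.sqrt_eq_rpow]; norm_num

lemma ab_pow12 (c d : ℝ) (hc : c = 3 ^ ((1:ℝ)/6)) (hd : d = 2 ^ ((1:ℝ)/3)) :
    0 < d ∧ d ^ 3 = 2 ∧ (2:ℝ) ^ ((2:ℝ)/3) = d ^ 2 ∧ (12:ℝ) ^ ((1:ℝ)/6) = d * c ∧
    (12:ℝ) ^ ((1:ℝ)/2) = d ^ 3 * c ^ 3 ∧ (12:ℝ) ^ ((5:ℝ)/6) = d ^ 5 * c ^ 5 := by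
  have h2 : (0:ℝ) < 2 := by norm_num
  have hp : ∀ n : ℕ, c ^ n = 3 ^ ((n:ℝ)/6) := by
    intro n
    rw [hc, ← Real.rpow_natCast, ← Real.rpow_mul (by norm_num)]; congr 1; ring
  have hq : ∀ n : ℕ, d ^ n = 2 ^ ((n:ℝ)/3) := by
    intro n
    rw [hd, ← Real.rpow_natCast, ← Real.rpow_mul (by norm_num)]; congr 1; ring
  have h12 : ∀ n : ℕ, (12:ℝ) ^ ((n:ℝ)/6) = d ^ n * c ^ n := by
    intro n
    have : (12:ℝ) = 2 ^ (2:ℝ) * 3 := by norm_num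
    rw [hp, hq, this, Real.mul_rpow (by positivity) (by norm_num), ← Real.rpow_mul (by norm_num)]
    congr 2; ring
  refine ⟨by rw [hd]; positivity, ?_, ?_, ?_, ?_, ?_⟩
  · rw [hq]; norm_num
  · rw [hq]; norm_num
  · have := h12 1; norm_num at this ⊢; exact this
  · have := h12 3; norm_num at this ⊢; exact this
  · have := h12 5; norm_num at this ⊢; exact this

lemma ab_Gamma (c d : ℝ) (hc : c = 3 ^ ((1:ℝ)/6)) (hd : d = 2 ^ ((1:ℝ)/3)) :
    Real.Gamma (1/3) * Real.Gamma (2/3) * c ^ 3 = 2 * Real.pi ∧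
    Real.Gamma (1/6) * Real.Gamma (2/3) = Real.Gamma (1/3) * d ^ 2 * Real.sqrt Real.pi ∧
    Real.Gamma (1/3) * Real.Gamma (5/6) = Real.Gamma (2/3) * d * Real.sqrt Real.pi := by
  obtain ⟨c0, -, -, -, -, hs⟩ := ab_pow3 c hc
  obtain ⟨d0, -, h2, -⟩ := ab_pow12 c d hc hd
  have a := Real.Gamma_mul_Gamma_one_sub (1/3)
  have b := Real.Gamma_mul_Gamma_add_half (1/6)
  have e := Real.Gamma_mul_Gamma_add_half (1/3)
  refine ⟨?_, ?_, ?_⟩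
  · rw [show Real.pi * (1/3) = Real.pi / 3 by ring, Real.sin_pi_div_three, hs] at a
    norm_num at a ⊢
    rw [a]; field_simp
  · rw [← h2]; norm_num at b ⊢; exact b
  · rw [hd]; norm_num at e ⊢; exact e

lemma ab_init (c d G1 G2 X Z S : ℝ) (c0 : 0 < c) (c6 : c ^ 6 = 3) (d3 : d ^ 3 = 2)
    (hG1 : 0 < G1) (hG2 : 0 < G2) (hS : 0 < S) (h1 : G1 * G2 * c ^ 3 = 2 * S ^ 2)
    (h2 : X * G2 = G1 * d ^ 2 * S) (h3 : G1 * Z = G2 * d * S) :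
    (c ^ 2 / 3 / G2) ^ 2 + (c ^ 5 / 3 / G2) ^ 2 = 1 / S ^ 3 * (d * c / 3 * X) ∧
    (c ^ 2 / 3 / G2) * (-(c ^ 4 / 3 / G1)) + (c ^ 5 / 3 / G2) * (c / G1)
      = 1 / S ^ 3 * (d ^ 3 * c ^ 3 / 3 * S / 2) ∧
    (-(c ^ 4 / 3 / G1)) ^ 2 + (c / G1) ^ 2 = 1 / S ^ 3 * (d ^ 5 * c ^ 5 / 3 * Z / 2) := by
  have c12 : c ^ 12 = 9 := by rw [show c ^ 12 = (c ^ 6) ^ 2 by ring, c6]; norm_num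
  have hX : X = 2 * S ^ 3 * d ^ 2 / (c ^ 3 * G2 ^ 2) := by
    rw [eq_div_iff (by positivity)]
    linear_combination c ^ 3 * G2 * h2 + d ^ 2 * S * h1
  have hZ : Z = 2 * S ^ 3 * d / (c ^ 3 * G1 ^ 2) := by
    rw [eq_div_iff (by positivity)]
    linear_combination c ^ 3 * G1 * h3 + d * S * h1
  have e1 : G2 = 2 * S ^ 2 / (c ^ 3 * G1) := by
    rw [eq_div_iff (by positivity)]
    linear_combination h1
  refine ⟨?_, ?_, ?_⟩
  · have : 1 / S ^ 3 * (d * c / 3 * X) = 2 * d ^ 3 / (3 * c ^ 2 * G2 ^ 2) := by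
      rw [hX]; field_simp
    rw [this, d3]
    have : c ^ 4 = 3 / c ^ 2 := by field_simp; linear_combination c6
    have e : (c ^ 2 / 3 / G2) ^ 2 + (c ^ 5 / 3 / G2) ^ 2 = c ^ 4 * (1 + c ^ 6) / (9 * G2 ^ 2) := by
      field_simp; norm_num
    rw [e, c6, this]; field_simp; norm_num
  · rw [d3, e1]
    have : c ^ 2 / 3 / (2 * S ^ 2 / (c ^ 3 * G1)) * -(c ^ 4 / 3 / G1) + c ^ 5 / 3 / (2 * S ^ 2 / (c ^ 3 * G1)) * (c / G1)
       = c ^ 3 * (c ^ 6 * 2 / 9) / (2 * S ^ 2) := by field_simp; ring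
    rw [this, c6]; field_simp; norm_num
  · have : 1 / S ^ 3 * (d ^ 5 * c ^ 5 / 3 * Z / 2) = (d ^ 3) ^ 2 * c ^ 2 / (3 * G1 ^ 2) := by
      rw [hZ]; field_simp
    rw [this, d3]
    have e : (-(c ^ 4 / 3 / G1)) ^ 2 + (c / G1) ^ 2 = c ^ 2 * (c ^ 6 / 9 + 1) / G1 ^ 2 := by
      field_simp; ring
    rw [e, c6]; field_simp; norm_num

theorem airy_bessel_modulus
    (Ai Ai' Bi Bi' J J' J'' Jm Jm' Jm'' Y : ℝ → ℝ)
    (hAi : ∀ x, HasDerivAt Ai (Ai' x) x)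
    (hAi' : ∀ x, HasDerivAt Ai' (x * Ai x) x)
    (hBi : ∀ x, HasDerivAt Bi (Bi' x) x)
    (hBi' : ∀ x, HasDerivAt Bi' (x * Bi x) x)
    (hAi0 : Ai 0 = 3 ^ (-(2:ℝ)/3) / Real.Gamma (2/3))
    (hAi'0 : Ai' 0 = -(3 ^ (-(1:ℝ)/3) / Real.Gamma (1/3)))
    (hBi0 : Bi 0 = 3 ^ (-(1:ℝ)/6) / Real.Gamma (2/3))
    (hBi'0 : Bi' 0 = 3 ^ ((1:ℝ)/6) / Real.Gamma (1/3))
    (hJ : ∀ x : ℝ, 0 < x → HasDerivAt J (J' x) x)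
    (hJ' : ∀ x : ℝ, 0 < x → HasDerivAt J' (J'' x) x)
    (hJode : ∀ x : ℝ, 0 < x →
      x^2 * J'' x + x * J' x + (x^2 - (2/3)^2) * J x = 0)
    (hJ0 : Filter.Tendsto (fun x : ℝ => J x / x ^ ((2:ℝ)/3))
      (nhdsWithin 0 (Set.Ioi 0)) (nhds (2 ^ (-(2:ℝ)/3) / Real.Gamma (5/3))))
    (hJm : ∀ x : ℝ, 0 < x → HasDerivAt Jm (Jm' x) x)
    (hJm' : ∀ x : ℝ, 0 < x → HasDerivAt Jm' (Jm'' x) x)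
    (hJmode : ∀ x : ℝ, 0 < x →
      x^2 * Jm'' x + x * Jm' x + (x^2 - (2/3)^2) * Jm x = 0)
    (hJm0 : Filter.Tendsto (fun x : ℝ => x ^ ((2:ℝ)/3) * Jm x)
      (nhdsWithin 0 (Set.Ioi 0)) (nhds (2 ^ ((2:ℝ)/3) / Real.Gamma (1/3))))
    (hJm1 : Filter.Tendsto
      (fun x : ℝ => (Jm x - 2 ^ ((2:ℝ)/3) / Real.Gamma (1/3) * x ^ (-(2:ℝ)/3))
        / x ^ ((2:ℝ)/3))
      (nhdsWithin 0 (Set.Ioi 0)) (nhds 0))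
    (hY : ∀ x : ℝ, 0 < x →
      Real.sin (2 * Real.pi / 3) * Y x = J x * Real.cos (2 * Real.pi / 3) - Jm x) :
    ∀ z : ℝ, 0 < z →
      z ^ (-(1:ℝ)/2) * (Ai' (-z) ^ 2 + Bi' (-z) ^ 2)
        = (1/2) * ((2/3) * z ^ ((3:ℝ)/2))
            * (J ((2/3) * z ^ ((3:ℝ)/2)) ^ 2 + Y ((2/3) * z ^ ((3:ℝ)/2)) ^ 2) ∧
      1 < Real.pi * z ^ (-(1:ℝ)/2) * (Ai' (-z) ^ 2 + Bi' (-z) ^ 2) := by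
  obtain ⟨c, hc⟩ : ∃ c : ℝ, c = 3 ^ ((1:ℝ)/6) := ⟨_, rfl⟩
  obtain ⟨d, hd⟩ : ∃ d : ℝ, d = 2 ^ ((1:ℝ)/3) := ⟨_, rfl⟩
  obtain ⟨c0, c6, p1, p2, p3, hs3⟩ := ab_pow3 c hc
  obtain ⟨d0, d3, q1, q2, q3, q4⟩ := ab_pow12 c d hc hd
  obtain ⟨g1, g2, g3⟩ := ab_Gamma c d hc hd
  have G53 : Real.Gamma (5/3) = 2/3 * Real.Gamma (2/3) := by
    rw [← Real.Gamma_add_one (by norm_num)]; norm_num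
  have hG1 : 0 < Real.Gamma (1/3) := Real.Gamma_pos_of_pos (by norm_num)
  have hG2 : 0 < Real.Gamma (2/3) := Real.Gamma_pos_of_pos (by norm_num)
  have hS : 0 < Real.sqrt Real.pi := Real.sqrt_pos.2 Real.pi_pos
  have hS2 : Real.sqrt Real.pi ^ 2 = Real.pi := Real.sq_sqrt Real.pi_pos.le
  have z1 : abI (-(1/2)) 0 = d * c / 3 * Real.Gamma (1/6) := by
    rw [ab_at_zero _ (by norm_num), ← q2]; norm_num
  have z2 : abI (1/2) 0 = d ^ 3 * c ^ 3 / 3 * Real.sqrt Real.pi := by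
    rw [ab_at_zero _ (by norm_num), ← q3, ← Real.Gamma_one_half_eq]; norm_num
  have z3 : abI (3/2) 0 = d ^ 5 * c ^ 5 / 3 * Real.Gamma (5/6) := by
    rw [ab_at_zero _ (by norm_num), ← q4]; norm_num
  rw [p1] at hAi0
  rw [p2] at hAi'0
  rw [p3] at hBi0
  rw [← hc] at hBi'0
  obtain ⟨I1, I2, I3⟩ := ab_init c d (Real.Gamma (1/3)) (Real.Gamma (2/3)) (Real.Gamma (1/6))
    (Real.Gamma (5/6)) (Real.sqrt Real.pi) c0 c6 d3 hG1 hG2 hS (by rw [hS2]; exact g1) g2 g3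
  generalize hG1' : Real.Gamma (1/3) = G1 at *
  generalize hG2' : Real.Gamma (2/3) = G2 at *
  -- the reflected Airy functions
  have hneg : ∀ z : ℝ, HasDerivAt (fun z : ℝ => -z) (-1) z := fun z => by
    exact (hasDerivAt_id z).neg
  have hu₁ : ∀ z, HasDerivAt (fun z => Ai' (-z)) (z * (fun z => Ai (-z)) z) z := fun z =>
    ((hAi' (-z)).comp z (hneg z)).congr_deriv (by ring)
  have ha₁ : ∀ z, HasDerivAt (fun z => Ai (-z)) (-(fun z => Ai' (-z)) z) z := fun z =>
    ((hAi (-z)).comp z (hneg z)).congr_deriv (by ring)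
  have hu₂ : ∀ z, HasDerivAt (fun z => Bi' (-z)) (z * (fun z => Bi (-z)) z) z := fun z =>
    ((hBi' (-z)).comp z (hneg z)).congr_deriv (by ring)
  have ha₂ : ∀ z, HasDerivAt (fun z => Bi (-z)) (-(fun z => Bi' (-z)) z) z := fun z =>
    ((hBi (-z)).comp z (hneg z)).congr_deriv (by ring)
  set u₁ : ℝ → ℝ := fun z => Ai' (-z) with hu1
  set a₁ : ℝ → ℝ := fun z => Ai (-z) with ha1
  set u₂ : ℝ → ℝ := fun z => Bi' (-z) with hu2
  set a₂ : ℝ → ℝ := fun z => Bi (-z) with ha2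
  have u10 : u₁ 0 = -(c ^ 4 / 3 / G1) := by simp only [hu1, neg_zero]; exact hAi'0
  have a10 : a₁ 0 = c ^ 2 / 3 / G2 := by simp only [ha1, neg_zero]; exact hAi0
  have u20 : u₂ 0 = c / G1 := by simp only [hu2, neg_zero]; exact hBi'0
  have a20 : a₂ 0 = c ^ 5 / 3 / G2 := by simp only [ha2, neg_zero]; exact hBi0
  have hW : u₂ 0 * a₁ 0 - u₁ 0 * a₂ 0 ≠ 0 := by
    rw [u10, a10, u20, a20, neg_mul, sub_neg_eq_add]; positivity
  -- integral representation
  have hrep : ∀ z, u₁ z ^ 2 + u₂ z ^ 2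
      - 1 / Real.sqrt Real.pi ^ 3 * (z * abI (-(1/2)) z + abI (3/2) z / 2) = 0 := by
    have dF : ∀ z, HasDerivAt (abI (-(1/2))) (-abI (1/2) z) z := fun z =>
      (ab_der (-(1/2)) z (by norm_num)).congr_deriv (by norm_num)
    have dG : ∀ z, HasDerivAt (abI (1/2)) (-abI (3/2) z) z := fun z =>
      (ab_der (1/2) z (by norm_num)).congr_deriv (by norm_num)
    have dN : ∀ z, HasDerivAt (abI (3/2)) (-abI (5/2) z) z := fun z =>
      (ab_der (3/2) z (by norm_num)).congr_deriv (by norm_num)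
    intro z
    generalize 1 / Real.sqrt Real.pi ^ 3 = κ at *
    refine ab_K (fun z => a₁ z ^ 2 + a₂ z ^ 2 - κ * abI (-(1/2)) z)
      (fun z => a₁ z * u₁ z + a₂ z * u₂ z - κ * (abI (1/2) z / 2))
      (fun z => u₁ z ^ 2 + u₂ z ^ 2 - κ * (z * abI (-(1/2)) z + abI (3/2) z / 2))
      ?_ ?_ ?_ ?_ ?_ ?_ u₁ a₁ u₂ a₂ hu₁ ha₁ hu₂ ha₂ hW z
    · intro z
      refine ((((ha₁ z).pow 2).add ((ha₂ z).pow 2)).sub ((dF z).const_mul κ)).congr_deriv ?_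
      norm_num; ring
    · intro z
      refine ((((ha₁ z).mul (hu₁ z)).add ((ha₂ z).mul (hu₂ z))).sub
        (((dG z).div_const 2).const_mul κ)).congr_deriv ?_
      ring
    · intro z
      refine ((((hu₁ z).pow 2).add ((hu₂ z).pow 2)).sub
        ((((hasDerivAt_id z).mul (dF z)).add ((dN z).div_const 2)).const_mul κ)).congr_deriv ?_
      simp only [id]
      norm_num
      linear_combination (-κ) * ab_parts z
    · simp only [a10, a20, z1]; linear_combination I1
    · simp only [a10, a20, u10, u20, z2]; linear_combination I2
    · simp only [u10, u20, z3]; linear_combination I3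
  -- substitution
  set ξ : ℝ → ℝ := fun z => (2/3) * z ^ ((3:ℝ)/2) with hξ
  have ξpos : ∀ z, 0 < z → 0 < ξ z := fun z hz => by simp only [hξ]; positivity
  have ξlim : Tendsto ξ (𝓝[>] 0) (𝓝[>] 0) := by
    refine tendsto_nhdsWithin_iff.2 ⟨?_, ?_⟩
    · have : Continuous ξ := by
        have : Continuous fun t : ℝ => t ^ ((3:ℝ)/2) := Real.continuous_rpow_const (by norm_num)
        fun_prop
      have := (this.tendsto 0).mono_left (nhdsWithin_le_nhds (s := Ioi 0))
      simp only [hξ] at this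
      rwa [Real.zero_rpow (by norm_num), mul_zero] at this
    · filter_upwards [self_mem_nhdsWithin] with z hz using ξpos z hz
  obtain ⟨k, hk⟩ : ∃ k : ℝ, k = (2/3) ^ ((2:ℝ)/3) := ⟨_, rfl⟩
  have k0 : 0 < k := by rw [hk]; positivity
  have hkc : k = d ^ 2 * (c ^ 2 / 3) := by
    rw [hk, Real.div_rpow (by norm_num) (by norm_num), q1, ← p1, neg_div, Real.rpow_neg (by norm_num)]
    rfl
  have ξ1 : ∀ z, 0 < z → ξ z ^ ((2:ℝ)/3) = k * z := by
    intro z hz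
    simp only [hξ]
    rw [Real.mul_rpow (by norm_num) (by positivity), ← Real.rpow_mul hz.le, hk]; norm_num
  have ξ2 : ∀ z, 0 < z → ξ z ^ (-(2:ℝ)/3) = 1 / (k * z) := by
    intro z hz
    rw [neg_div, Real.rpow_neg (ξpos z hz).le, ξ1 z hz, one_div]
  have r2 : (2:ℝ) ^ (-(2:ℝ)/3) = 1 / d ^ 2 := by
    rw [neg_div, Real.rpow_neg (by norm_num), q1, one_div]
  -- limits
  have LP : Tendsto (fun z => z * J (ξ z) / z ^ 2) (𝓝[>] 0) (𝓝 (c ^ 2 / (2 * G2))) := by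
    have := (hJ0.comp ξlim).mul_const k
    have e : 2 ^ (-(2:ℝ)/3) / Real.Gamma (5/3) * k = c ^ 2 / (2 * G2) := by
      rw [r2, G53, hkc]; field_simp
    rw [e] at this
    refine this.congr' ?_
    filter_upwards [self_mem_nhdsWithin] with z hz
    have hz : 0 < z := hz
    simp only [Function.comp]
    rw [ξ1 z hz]
    field_simp
  have LQ : Tendsto (fun z => (z * Jm (ξ z) - c ^ 4 / G1) / z ^ 2) (𝓝[>] 0) (𝓝 0) := by
    have := (hJm1.comp ξlim).mul_const k
    rw [zero_mul] at this
    refine this.congr' ?_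
    filter_upwards [self_mem_nhdsWithin] with z hz
    have hz : 0 < z := hz
    simp only [Function.comp]
    rw [ξ1 z hz, ξ2 z hz, q1]
    have e : c ^ 4 / G1 = d ^ 2 / (G1 * k) := by
      rw [hkc]; field_simp; linear_combination c6
    rw [e]
    field_simp
  have SP := fun z (hz : 0 < z) => ab_sol J J' J'' hJ hJ' hJode z hz
  have SQ := fun z (hz : 0 < z) => ab_sol Jm Jm' Jm'' hJm hJm' hJmode z hz
  have c8 : c ^ 8 = 3 * c ^ 2 := by linear_combination c ^ 2 * c6
  have hP : ∀ z, 0 < z → z * J (ξ z) - (3 * u₁ z + c ^ 3 * u₂ z) / 2 = 0 := by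
    have dU : ∀ z, HasDerivAt (fun z => (3 * u₁ z + c ^ 3 * u₂ z) / 2)
        (z * (fun z => (3 * a₁ z + c ^ 3 * a₂ z) / 2) z) z := fun z =>
      ((((hu₁ z).const_mul 3).add ((hu₂ z).const_mul (c ^ 3))).div_const 2).congr_deriv (by ring)
    have dA : ∀ z, HasDerivAt (fun z => (3 * a₁ z + c ^ 3 * a₂ z) / 2)
        (-(fun z => (3 * u₁ z + c ^ 3 * u₂ z) / 2) z) z := fun z =>
      ((((ha₁ z).const_mul 3).add ((ha₂ z).const_mul (c ^ 3))).div_const 2).congr_deriv (by ring)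
    refine ab_zero u₁ a₁ u₂ a₂ _ _ hu₁ ha₁ hu₂ ha₂ hW
      (fun z hz => ((SP z hz).1.sub (dU z)).congr_deriv (mul_sub _ _ _).symm)
      (fun z hz => ((SP z hz).2.sub (dA z)).congr_deriv (by ring)) ?_
    have h0 : (3 * u₁ 0 + c ^ 3 * u₂ 0) / 2 = 0 := by rw [u10, u20]; field_simp; ring
    have h1 : (3 * a₁ 0 + c ^ 3 * a₂ 0) / 2 / 2 = c ^ 2 / (2 * G2) := by
      rw [a10, a20]; field_simp; linear_combination c6
    have h2 := LP.sub (ab_lim _ _ dU dA)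
    simp only [h0, h1, sub_self, sub_zero] at h2
    refine h2.congr fun z => ?_
    ring
  have hQ : ∀ z, 0 < z → z * Jm (ξ z) - (c ^ 3 * u₂ z - 3 * u₁ z) / 2 = 0 := by
    have dU : ∀ z, HasDerivAt (fun z => (c ^ 3 * u₂ z - 3 * u₁ z) / 2)
        (z * (fun z => (c ^ 3 * a₂ z - 3 * a₁ z) / 2) z) z := fun z =>
      ((((hu₂ z).const_mul (c ^ 3)).sub ((hu₁ z).const_mul 3)).div_const 2).congr_deriv (by ring)
    have dA : ∀ z, HasDerivAt (fun z => (c ^ 3 * a₂ z - 3 * a₁ z) / 2)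
        (-(fun z => (c ^ 3 * u₂ z - 3 * u₁ z) / 2) z) z := fun z =>
      ((((ha₂ z).const_mul (c ^ 3)).sub ((ha₁ z).const_mul 3)).div_const 2).congr_deriv (by ring)
    refine ab_zero u₁ a₁ u₂ a₂ _ _ hu₁ ha₁ hu₂ ha₂ hW
      (fun z hz => ((SQ z hz).1.sub (dU z)).congr_deriv (mul_sub _ _ _).symm)
      (fun z hz => ((SQ z hz).2.sub (dA z)).congr_deriv (by ring)) ?_
    have h0 : (c ^ 3 * u₂ 0 - 3 * u₁ 0) / 2 = c ^ 4 / G1 := by rw [u10, u20]; field_simp; ring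
    have h1 : (c ^ 3 * a₂ 0 - 3 * a₁ 0) / 2 / 2 = 0 := by
      rw [a10, a20]; field_simp; linear_combination c ^ 2 * c6
    have h2 := LQ.sub (ab_lim _ _ dU dA)
    simp only [h0, h1, sub_self, sub_zero] at h2
    refine h2.congr fun z => ?_
    ring
  -- conclusion
  intro z hz
  have hs : 0 < Real.sqrt z := Real.sqrt_pos.2 hz
  have hs2 : Real.sqrt z ^ 2 = z := Real.sq_sqrt hz.le
  have hsm : z ^ (-(1:ℝ)/2) = 1 / Real.sqrt z := by
    rw [neg_div, Real.rpow_neg hz.le, ← Real.sqrt_eq_rpow, one_div]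
  have h3 : z ^ ((3:ℝ)/2) = Real.sqrt z ^ 3 := by
    rw [Real.sqrt_eq_rpow, ← Real.rpow_natCast, ← Real.rpow_mul hz.le]; norm_num
  rw [hsm]
  constructor
  · have hY' := hY _ (ξpos z hz)
    have e : 2 * Real.pi / 3 = Real.pi - Real.pi / 3 := by ring
    rw [e, Real.sin_pi_sub, Real.cos_pi_sub, Real.sin_pi_div_three, Real.cos_pi_div_three, hs3] at hY'
    have hP' := hP z hz
    have hQ' := hQ z hz
    change 1 / Real.sqrt z * (u₁ z ^ 2 + u₂ z ^ 2) = 1 / 2 * (2 / 3 * z ^ ((3:ℝ)/2)) * (J (ξ z) ^ 2 + Y (ξ z) ^ 2)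
    rw [h3]
    generalize J (ξ z) = A at *
    generalize Jm (ξ z) = B at *
    generalize Y (ξ z) = C at *
    have e1 : u₁ z = z * (A - B) / 3 := by linarith
    have e2 : u₂ z = z * (A + B) / c ^ 3 := by
      rw [eq_div_iff (by positivity)]; linarith
    have e3 : C = -(A + 2 * B) / c ^ 3 := by
      rw [eq_div_iff (by positivity)]; linarith
    have e4 : u₂ z ^ 2 = (z * (A + B)) ^ 2 / 3 := by
      rw [e2, div_pow, ← pow_mul]; norm_num [c6]
    have e5 : C ^ 2 = (A + 2 * B) ^ 2 / 3 := by
      rw [e3, div_pow, ← pow_mul]; norm_num [c6]; ring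
    rw [e1, e4, e5, ← hs2]
    have : Real.sqrt (Real.sqrt z ^ 2) = Real.sqrt z := by rw [hs2]
    rw [this]
    field_simp
    ring
  · have hr := hrep z
    have hi := ab_ineq z hz
    change 1 < Real.pi * (1 / Real.sqrt z) * (u₁ z ^ 2 + u₂ z ^ 2)
    have e : u₁ z ^ 2 + u₂ z ^ 2
      = 1 / Real.sqrt Real.pi ^ 3 * (z * abI (-(1/2)) z + abI (3/2) z / 2) := by linarith
    rw [e]
    generalize z * abI (-(1/2)) z + abI (3/2) z / 2 = V at *
    have : Real.pi * (1 / Real.sqrt z) * (1 / Real.sqrt Real.pi ^ 3 * V)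
        = V / (Real.sqrt Real.pi * Real.sqrt z) := by
      nth_rewrite 1 [← hS2]
      field_simp
    rw [this, one_lt_div (by positivity)]
    exact hi
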